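/- For every finite simple graph G, the minimum size of an identifying code of G (in the relaxed, non-twin sense) equals the minimum size of an identifying code of its maximal twin-free induced subgraph G\R. -/

import Mathlib

open SimpleGraph

variable {V : Type*}

/-- The closed neighborhood `N[u]` of a vertex `u`. -/
def closedNbhd (G : SimpleGraph V) (u : V) : Set V := insert u (G.neighborSet u)

/-- Two vertices are twins if they have the same closed neighborhood. -/
def Twins (G : SimpleGraph V) (u v : V) : Prop := closedNbhd G u = closedNbhd G v

/-- `s` is a set of representatives of the twin-equivalence classes of `G`:
it contains exactly one vertex from each class. The induced subgraph of `G` on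
such a set is the maximal twin-free induced subgraph `G\R` (the quotient of `G`
by the twin relation `R`), well-defined up to isomorphism. -/
def IsRepSet (G : SimpleGraph V) (s : Finset V) : Prop :=
  ∀ v : V, ∃! w, w ∈ s ∧ Twins G v w

/-- `C` is an identifying code of `G` in the relaxed (non-twin) sense: any two
non-twin vertices have distinct traces of their closed neighborhoods on `C`. -/
def IsIdCode (G : SimpleGraph V) (C : Set V) : Prop :=
  ∀ u v : V, ¬ Twins G u v → closedNbhd G u ∩ C ≠ closedNbhd G v ∩ C

/-- The minimum size of an identifying code of `G` (relaxed, non-twin sense). -/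
noncomputable def minIdCodeSize (G : SimpleGraph V) : ℕ :=
  sInf {n | ∃ C : Finset V, C.card = n ∧ IsIdCode G ↑C}

theorem mem_closedNbhd_comm (G : SimpleGraph V) (u v : V) :
    u ∈ closedNbhd G v ↔ v ∈ closedNbhd G u := by
  simp only [closedNbhd, Set.mem_insert_iff, SimpleGraph.mem_neighborSet, G.adj_comm, eq_comm]

theorem Twins.mem_closedNbhd_iff {G : SimpleGraph V} {u v : V} (h : Twins G u v) (w : V) :
    u ∈ closedNbhd G w ↔ v ∈ closedNbhd G w := by
  rw [mem_closedNbhd_comm, mem_closedNbhd_comm G v, h]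

theorem isIdCode_univ (G : SimpleGraph V) : IsIdCode G Set.univ := by
  intro u v huv
  rwa [Set.inter_univ, Set.inter_univ]

theorem closedNbhd_inter_eq_iff {G : SimpleGraph V} {C : Set V} {u v : V} :
    closedNbhd G u ∩ C = closedNbhd G v ∩ C ↔
      ∀ x ∈ C, x ∈ closedNbhd G u ↔ x ∈ closedNbhd G v := by
  simp only [Set.ext_iff, Set.mem_inter_iff, and_congr_left_iff]

/-- A map that preserves and reflects closed neighborhoods, and meets every twin class of the
target, sends identifying codes to identifying codes. -/
theorem IsIdCode.image {W : Type*} {G : SimpleGraph V} {H : SimpleGraph W} {f : V → W}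
    (hf : ∀ u v, f u ∈ closedNbhd H (f v) ↔ u ∈ closedNbhd G v)
    (hsurj : ∀ w, ∃ v, Twins H w (f v)) {C : Set V} (hC : IsIdCode G C) :
    IsIdCode H (f '' C) := by
  intro w₁ w₂ hne heq
  obtain ⟨v₁, h₁⟩ := hsurj w₁
  obtain ⟨v₂, h₂⟩ := hsurj w₂
  rw [Twins, h₁, h₂] at hne
  rw [h₁, h₂, closedNbhd_inter_eq_iff] at heq
  refine hC v₁ v₂ (fun htw => hne ?_) (closedNbhd_inter_eq_iff.2 fun x hx => ?_)
  · ext y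
    obtain ⟨z, hz⟩ := hsurj y
    rw [hz.mem_closedNbhd_iff, hz.mem_closedNbhd_iff, hf, hf, htw]
  · rw [← hf, ← hf]
    exact heq _ ⟨x, hx, rfl⟩

theorem minIdCodeSize_le_of_map {W : Type*} [Fintype V] {G : SimpleGraph V} {H : SimpleGraph W}
    {f : V → W} (hf : ∀ u v, f u ∈ closedNbhd H (f v) ↔ u ∈ closedNbhd G v)
    (hsurj : ∀ w, ∃ v, Twins H w (f v)) :
    minIdCodeSize H ≤ minIdCodeSize G := by
  classical
  have hne : {n | ∃ C : Finset V, C.card = n ∧ IsIdCode G ↑C}.Nonempty :=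
    ⟨_, Finset.univ, rfl, by simpa using isIdCode_univ G⟩
  obtain ⟨C, hcard, hC⟩ := Nat.sInf_mem hne
  calc minIdCodeSize H ≤ (C.image f).card :=
        Nat.sInf_le ⟨C.image f, rfl, by simpa using hC.image hf hsurj⟩
    _ ≤ C.card := Finset.card_image_le
    _ = minIdCodeSize G := hcard

theorem mem_closedNbhd_induce {G : SimpleGraph V} {s : Set V} (u v : s) :
    u ∈ closedNbhd (G.induce s) v ↔ (u : V) ∈ closedNbhd G v := by
  simp [closedNbhd, Subtype.ext_iff]

/-- For every finite simple graph `G`, the minimum size of an identifying code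
of `G` (in the relaxed, non-twin sense) equals the minimum size of an
identifying code of its maximal twin-free induced subgraph `G\R`. -/
theorem minIdCodeSize_eq_quotient [Fintype V] (G : SimpleGraph V)
    (s : Finset V) (hs : IsRepSet G s) :
    minIdCodeSize G = minIdCodeSize (G.induce (↑s : Set V)) := by
  choose r hr using fun v => (hs v).exists
  apply le_antisymm
  · exact minIdCodeSize_le_of_map (f := Subtype.val)
      (fun u v => (mem_closedNbhd_induce u v).symm) fun v => ⟨⟨r v, (hr v).1⟩, (hr v).2⟩
  · refine minIdCodeSize_le_of_map (f := fun v => ⟨r v, (hr v).1⟩) (fun u v => ?_) fun w => ⟨w, ?_⟩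
    · rw [mem_closedNbhd_induce, ← (hr u).2.mem_closedNbhd_iff, ← (hr v).2]
    · ext y
      rw [mem_closedNbhd_induce, mem_closedNbhd_induce, (hr w).2]
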